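/- Let G be a simple graph on [0,n] and F ⊆ E(G\0). Then the flow polytopes F_{Gr(G)}(a_G^F) and F_{H_G}(d_1^F, d_2^F, ..., d_n^F, −#E(G\F)) are integrally equivalent, where d_j^F = indeg_G(j) − outdeg_F(j) for j ∈ [n] and #E(G\F) = #E(G) − #F. -/

import Mathlib

noncomputable section

open Finset

/-- The flow polytope of a directed graph with edge index set `ι`, edges `e` going from
`src e` to `tgt e`, and netflow vector `a`. -/
def flowPolytope {V ι : Type*} [Fintype ι] [DecidableEq V]
    (src tgt : ι → V) (a : V → ℝ) : Set (ι → ℝ) :=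
  {f | (∀ e, 0 ≤ f e) ∧
    ∀ v, (∑ e, if src e = v then f e else 0) - (∑ e, if tgt e = v then f e else 0) = a v}

/-- Integral equivalence of polytopes. -/
def IntegrallyEquivalent {ι κ : Type*} (P : Set (ι → ℝ)) (Q : Set (κ → ℝ)) : Prop :=
  ∃ T : (ι → ℝ) →ᵃ[ℝ] (κ → ℝ),
    Set.BijOn T P Q ∧
    Set.BijOn T ((affineSpan ℝ P : Set (ι → ℝ)) ∩ {f | ∀ i, ∃ z : ℤ, f i = (z : ℝ)})
      ((affineSpan ℝ Q : Set (κ → ℝ)) ∩ {f | ∀ i, ∃ z : ℤ, f i = (z : ℝ)})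

/-- `E(G\0)`: the edges of `G` not incident to the vertex `0`. -/
def EG0 (n : ℕ) (G : Finset (Fin (n + 1) × Fin (n + 1))) :
    Finset (Fin (n + 1) × Fin (n + 1)) :=
  G.filter fun e => (e.1 : ℕ) ≠ 0

/-- `indeg_G(v)`: number of edges of `G` ending at `v`. -/
def indeg (n : ℕ) (G : Finset (Fin (n + 1) × Fin (n + 1))) (v : Fin (n + 1)) : ℕ :=
  (G.filter fun e => e.2 = v).card

/-- The index set `{(i,j) : 1 ≤ j ≤ i ≤ n}` of the variables `a_{i,j}` of the triangular
constraint array (a pair `p` encodes `i = p.1`, `j = p.2`). -/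
abbrev TriIdx (n : ℕ) : Type :=
  {p : Fin (n + 1) × Fin (n + 1) // 1 ≤ (p.2 : ℕ) ∧ (p.2 : ℕ) ≤ (p.1 : ℕ)}

/-- `f_{i,j} = #{(j,k) ∈ F : k ≤ i}`. -/
def fval (n : ℕ) (F : Finset (Fin (n + 1) × Fin (n + 1))) (i j : ℕ) : ℕ :=
  (F.filter fun e => (e.1 : ℕ) = j ∧ (e.2 : ℕ) ≤ i).card

/-- `Poly(Tri_G(F))`: the solution set of the constraint system `Tri_G(F)`, namely:
`a_{1,1} = #{edges of G from 0 to 1}`; for `1 ≤ j < i ≤ n`,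
`a_{i,j} + f_{i,j} ≤ a_{i-1,j} + f_{i-1,j}` if `(j,i) ∈ E(G)` and
`a_{i,j} + f_{i,j} = a_{i-1,j} + f_{i-1,j}` otherwise; for `1 < i ≤ n`,
`a_{i,i} = #E(G[0,i]) − ∑_{k=1}^{i-1} (a_{i,k} + f_{i,k})`; and `a_{n,j} ≥ 0`. -/
def polyTri (n : ℕ) (G F : Finset (Fin (n + 1) × Fin (n + 1))) : Set (TriIdx n → ℝ) :=
  {x |
    (∀ p : TriIdx n, (p.1.1 : ℕ) = 1 →
      x p = ((G.filter fun e => (e.1 : ℕ) = 0 ∧ (e.2 : ℕ) = 1).card : ℝ)) ∧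
    (∀ p q : TriIdx n, (p.1.2 : ℕ) = (q.1.2 : ℕ) → (q.1.1 : ℕ) + 1 = (p.1.1 : ℕ) →
      (p.1.2 : ℕ) < (p.1.1 : ℕ) →
      if (p.1.2, p.1.1) ∈ G then
        x p + (fval n F (p.1.1 : ℕ) (p.1.2 : ℕ) : ℝ) ≤
          x q + (fval n F (q.1.1 : ℕ) (q.1.2 : ℕ) : ℝ)
      else
        x p + (fval n F (p.1.1 : ℕ) (p.1.2 : ℕ) : ℝ) =
          x q + (fval n F (q.1.1 : ℕ) (q.1.2 : ℕ) : ℝ)) ∧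
    (∀ p : TriIdx n, p.1.1 = p.1.2 → 2 ≤ (p.1.1 : ℕ) →
      x p = ((G.filter fun e => (e.2 : ℕ) ≤ (p.1.1 : ℕ)).card : ℝ) -
        ∑ q ∈ Finset.univ.filter
            (fun q : TriIdx n => q.1.1 = p.1.1 ∧ (q.1.2 : ℕ) < (p.1.1 : ℕ)),
          (x q + (fval n F (q.1.1 : ℕ) (q.1.2 : ℕ) : ℝ))) ∧
    (∀ p : TriIdx n, (p.1.1 : ℕ) = n → 0 ≤ x p)}

/-- Source map of the graph `Gr(G)`, whose vertices are the `v_{i,j}` for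
`1 ≤ j ≤ i ≤ n` together with `v_{n+1,n+1}` (modeled as `Option (Fin (n+1) × Fin (n+1))`
with `none = v_{n+1,n+1}`; invalid pairs are unused isolated vertices).  Its edges are:
one edge `a_{i,j} : v_{i,j} → v_{i+1,j}` for each `1 ≤ j ≤ i ≤ n` (where `v_{n+1,j}`
means `v_{n+1,n+1}`), and one edge `z_{i,j} : v_{i,j} → v_{i,i}` for each edge
`(j,i) ∈ E(G\0)`. -/
def srcGr (n : ℕ) (G : Finset (Fin (n + 1) × Fin (n + 1))) :
    (TriIdx n ⊕ ↥(EG0 n G)) → Option (Fin (n + 1) × Fin (n + 1))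
  | Sum.inl p => some p.1
  | Sum.inr e => some (e.1.2, e.1.1)

/-- Target map of `Gr(G)`. -/
def tgtGr (n : ℕ) (G : Finset (Fin (n + 1) × Fin (n + 1))) :
    (TriIdx n ⊕ ↥(EG0 n G)) → Option (Fin (n + 1) × Fin (n + 1))
  | Sum.inl p =>
      if h : (p.1.1 : ℕ) < n then some (⟨(p.1.1 : ℕ) + 1, by omega⟩, p.1.2) else none
  | Sum.inr e => some (e.1.2, e.1.2)

/-- The netflow vector `a_G^F` on the vertices of `Gr(G)`: `indeg_G(j)` at `v_{j,j}`
(`j ∈ [n]`), `f_{i-1,j} − f_{i,j}` at `v_{i,j}` (`1 ≤ j < i ≤ n`),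
`−#E(G) + ∑_{k=1}^{n-1} f_{n,k}` at `v_{n+1,n+1}`, and `0` at the unused vertices. -/
def aGrF (n : ℕ) (G F : Finset (Fin (n + 1) × Fin (n + 1))) :
    Option (Fin (n + 1) × Fin (n + 1)) → ℝ
  | none => -(G.card : ℝ) + ∑ k ∈ Finset.Icc 1 (n - 1), (fval n F n k : ℝ)
  | some p =>
      if p.1 = p.2 then (if 1 ≤ (p.1 : ℕ) then (indeg n G p.1 : ℝ) else 0)
      else if 1 ≤ (p.2 : ℕ) ∧ (p.2 : ℕ) < (p.1 : ℕ) then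
        (fval n F ((p.1 : ℕ) - 1) (p.2 : ℕ) : ℝ) - (fval n F (p.1 : ℕ) (p.2 : ℕ) : ℝ)
      else 0

/-- Source map of the graph `H_G` on the vertex set `[n] ∪ {t}` (modeled as
`Option (Fin (n+1))` with `none = t`; the vertex `some 0` is unused): the edges are the
edges `(j,i)` of `G` with `1 ≤ j < i ≤ n` together with one edge `(j,t)` for each
`j ∈ [n]`. -/
def srcH (n : ℕ) (G : Finset (Fin (n + 1) × Fin (n + 1))) :
    (↥(EG0 n G) ⊕ Fin n) → Option (Fin (n + 1))
  | Sum.inl e => some e.1.1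
  | Sum.inr i => some i.succ

/-- Target map of `H_G`. -/
def tgtH (n : ℕ) (G : Finset (Fin (n + 1) × Fin (n + 1))) :
    (↥(EG0 n G) ⊕ Fin n) → Option (Fin (n + 1))
  | Sum.inl e => some e.1.2
  | Sum.inr _ => none

/-- `outdeg_F(v)`: number of edges of `F` starting at `v`. -/
def outdeg (n : ℕ) (F : Finset (Fin (n + 1) × Fin (n + 1))) (v : Fin (n + 1)) : ℕ :=
  (F.filter fun e => e.1 = v).card

/-- The netflow vector `(d_1^F, …, d_n^F, −#E(G\F))` on the vertices of `H_G`, where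
`d_j^F = indeg_G(j) − outdeg_F(j)` and `#E(G\F) = #E(G) − #F`. -/
def bGF (n : ℕ) (G F : Finset (Fin (n + 1) × Fin (n + 1))) : Option (Fin (n + 1)) → ℝ
  | none => -((G.card : ℝ) - (F.card : ℝ))
  | some v => if v = 0 then 0 else (indeg n G v : ℝ) - (outdeg n F v : ℝ)

theorem mapsTo_affineSpan {α β : Type*} {A : Set (α → ℝ)} {B : Set (β → ℝ)}
    (R : (α → ℝ) →ᵃ[ℝ] (β → ℝ)) (h : Set.MapsTo R A B) :
    Set.MapsTo R (affineSpan ℝ A) (affineSpan ℝ B) := by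
  intro x hx
  have h1 : R x ∈ (affineSpan ℝ A).map R := AffineSubspace.mem_map_of_mem R hx
  rw [AffineSubspace.map_span] at h1
  exact affineSpan_mono ℝ h.image_subset h1

theorem leftInvOn_affineSpan {α β : Type*} {A : Set (α → ℝ)}
    (R : (α → ℝ) →ᵃ[ℝ] (β → ℝ)) (R' : (β → ℝ) →ᵃ[ℝ] (α → ℝ)) (h : Set.LeftInvOn R' R A) :
    Set.LeftInvOn R' R (affineSpan ℝ A) := by
  have h1 : Set.EqOn (R'.comp R) (AffineMap.id ℝ (α → ℝ)) A := fun x hx => h hx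
  exact fun x hx => AffineMap.eqOn_affineSpan h1 hx

/-- Affine maps that preserve integrality and restrict to mutually inverse maps between `P` and
`Q` exhibit an integral equivalence. -/
theorem IntegrallyEquivalent.of_inverse {ι κ : Type*} {P : Set (ι → ℝ)} {Q : Set (κ → ℝ)}
    (T : (ι → ℝ) →ᵃ[ℝ] (κ → ℝ)) (S : (κ → ℝ) →ᵃ[ℝ] (ι → ℝ))
    (hT : Set.MapsTo T P Q) (hS : Set.MapsTo S Q P)
    (hST : Set.LeftInvOn S T P) (hTS : Set.LeftInvOn T S Q)
    (hTint : ∀ x : ι → ℝ, (∀ i, ∃ z : ℤ, x i = z) → ∀ k, ∃ z : ℤ, T x k = z)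
    (hSint : ∀ y : κ → ℝ, (∀ k, ∃ z : ℤ, y k = z) → ∀ i, ∃ z : ℤ, S y i = z) :
    IntegrallyEquivalent P Q := by
  refine ⟨T, Set.InvOn.bijOn ⟨hST, hTS⟩ hT hS, Set.InvOn.bijOn (f' := S) ⟨?_, ?_⟩ ?_ ?_⟩
  · exact fun x hx => leftInvOn_affineSpan T S hST hx.1
  · exact fun y hy => leftInvOn_affineSpan S T hTS hy.1
  · exact fun x hx => ⟨mapsTo_affineSpan T hT hx.1, hTint x hx.2⟩
  · exact fun y hy => ⟨mapsTo_affineSpan S hS hy.1, hSint y hy.2⟩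

section GrContraction

variable {n : ℕ} {G F : Finset (Fin (n + 1) × Fin (n + 1))}

/-- The index `(i, j)` of the variable `a_{i,j}`. -/
def triIdx (i j : Fin (n + 1)) (hj : 1 ≤ (j : ℕ)) (hji : (j : ℕ) ≤ i) : TriIdx n :=
  ⟨(i, j), hj, hji⟩

/-- The index `(n, j)` of the variable `a_{n,j}`. -/
def botIdx (j : Fin n) : TriIdx n :=
  triIdx (Fin.last n) j.succ (by simp) (by simp)

/-- The index `(i + 1, j)`. -/
def TriIdx.next (p : TriIdx n) (h : (p.1.1 : ℕ) < n) : TriIdx n :=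
  triIdx ⟨(p.1.1 : ℕ) + 1, by omega⟩ p.1.2 p.2.1 (by have := p.2.2; simp; omega)

/-- The netflow of `f` at the vertex `v`. -/
def netflow {V ι : Type*} [Fintype ι] [DecidableEq V] (src tgt : ι → V) (f : ι → ℝ) (v : V) : ℝ :=
  (∑ e, if src e = v then f e else 0) - (∑ e, if tgt e = v then f e else 0)

/-- The edge of `Gr(G)` corresponding to an edge of `H_G` that survives the contraction. -/
def grEdge (n : ℕ) (G : Finset (Fin (n + 1) × Fin (n + 1))) :
    ↥(EG0 n G) ⊕ Fin n → TriIdx n ⊕ ↥(EG0 n G)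
  | Sum.inl e => Sum.inr e
  | Sum.inr j => Sum.inl (botIdx j)

/-- The indicator function of `F` on the edges of `G`. -/
def indF (F : Finset (Fin (n + 1) × Fin (n + 1))) (e : Fin (n + 1) × Fin (n + 1)) : ℝ :=
  if e ∈ F then 1 else 0

theorem lt_of_mem_EG0 (hG : ∀ e ∈ G, e.1 < e.2) (e : ↥(EG0 n G)) :
    1 ≤ (e.1.1 : ℕ) ∧ (e.1.1 : ℕ) < e.1.2 := by
  obtain ⟨h1, h2⟩ := Finset.mem_filter.1 e.2
  exact ⟨Nat.one_le_iff_ne_zero.2 h2, hG _ h1⟩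

theorem sum_indF (hF : F ⊆ EG0 n G) (p : Fin (n + 1) × Fin (n + 1) → Prop) [DecidablePred p] :
    (∑ e : ↥(EG0 n G), if p e.1 then indF F e.1 else 0) = ((F.filter p).card : ℝ) := by
  rw [Finset.sum_coe_sort (EG0 n G) (fun e => if p e then indF F e else 0)]
  rw [← Finset.sum_subset hF (by intro e _ he; simp [indF, he])]
  rw [Finset.card_filter]
  push_cast
  exact Finset.sum_congr rfl fun e he => by simp [indF, he]

theorem netflow_gr_diag (hG : ∀ e ∈ G, e.1 < e.2) (f : TriIdx n ⊕ ↥(EG0 n G) → ℝ)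
    (j : Fin (n + 1)) (hj : 1 ≤ (j : ℕ)) :
    netflow (srcGr n G) (tgtGr n G) f (some (j, j)) =
      f (Sum.inl (triIdx j j hj le_rfl)) - ∑ e : ↥(EG0 n G), if e.1.2 = j then f (Sum.inr e) else 0
    := by
  have h1 : ∀ p : TriIdx n, srcGr n G (Sum.inl p) = some (j, j) ↔ p = triIdx j j hj le_rfl := by
    intro p; simp [srcGr, triIdx, Subtype.ext_iff]
  have h2 : ∀ e, srcGr n G (Sum.inr e) ≠ some (j, j) := by
    intro e h
    have := lt_of_mem_EG0 hG e
    simp [srcGr, Prod.ext_iff] at h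
    omega
  have h3 : ∀ p : TriIdx n, tgtGr n G (Sum.inl p) ≠ some (j, j) := by
    intro p h
    have := p.2
    simp only [tgtGr] at h
    split_ifs at h
    simp [Prod.ext_iff, Fin.ext_iff] at h
    omega
  have h4 : ∀ e, tgtGr n G (Sum.inr e) = some (j, j) ↔ e.1.2 = j := by
    intro e; simp [tgtGr]
  simp [netflow, Fintype.sum_sum_type, h1, h2, h3, h4]

theorem netflow_gr_next (f : TriIdx n ⊕ ↥(EG0 n G) → ℝ)
    (p : TriIdx n) (hp : (p.1.1 : ℕ) < n) :
    netflow (srcGr n G) (tgtGr n G) f (some (p.next hp).1) =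
      f (Sum.inl (p.next hp)) +
        (∑ e : ↥(EG0 n G), if e.1.1 = p.1.2 ∧ (e.1.2 : ℕ) = p.1.1 + 1 then f (Sum.inr e) else 0) -
        f (Sum.inl p) := by
  have h1 : ∀ q : TriIdx n, srcGr n G (Sum.inl q) = some (p.next hp).1 ↔ q = p.next hp := by
    intro q; simp [srcGr, Subtype.ext_iff]
  have h2 : ∀ e, srcGr n G (Sum.inr e) = some (p.next hp).1 ↔
      e.1.1 = p.1.2 ∧ (e.1.2 : ℕ) = p.1.1 + 1 := by
    intro e; simp [srcGr, TriIdx.next, triIdx, Prod.ext_iff, Fin.ext_iff, and_comm]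
  have h3 : ∀ q : TriIdx n, tgtGr n G (Sum.inl q) = some (p.next hp).1 ↔ q = p := by
    intro q
    simp only [tgtGr, TriIdx.next, triIdx]
    split_ifs with h
    · simp [Prod.ext_iff, Fin.ext_iff, Subtype.ext_iff]
    · simp only [false_iff]
      rintro rfl
      exact h hp
  have h4 : ∀ e, tgtGr n G (Sum.inr e) ≠ some (p.next hp).1 := by
    intro e h
    have := p.2
    simp [tgtGr, TriIdx.next, triIdx, Prod.ext_iff, Fin.ext_iff] at h
    omega
  simp [netflow, Fintype.sum_sum_type, h1, h2, h3, h4]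

theorem netflow_gr_none (f : TriIdx n ⊕ ↥(EG0 n G) → ℝ) :
    netflow (srcGr n G) (tgtGr n G) f none = - ∑ j : Fin n, f (Sum.inl (botIdx j)) := by
  have h1 : ∀ q, srcGr n G q ≠ none := by rintro (q | q) <;> simp [srcGr]
  have h2 : ∀ q, tgtGr n G (Sum.inr q) ≠ none := by simp [tgtGr]
  have h3 : ∀ q : TriIdx n, tgtGr n G (Sum.inl q) = none ↔ q.1.1 = Fin.last n := by
    intro q
    have := q.1.1.2
    simp only [tgtGr, Fin.ext_iff, Fin.val_last]
    split_ifs <;> simp <;> omega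
  simp only [netflow, Fintype.sum_sum_type, h1, h2, h3, if_false, Finset.sum_const_zero, zero_sub,
    add_zero, neg_inj]
  rw [← Finset.sum_filter]
  symm
  refine Finset.sum_bij (fun j _ => botIdx j) ?_ ?_ ?_ (fun _ _ => rfl)
  · simp [botIdx, triIdx]
  · simp [botIdx, triIdx, Subtype.ext_iff]
  · intro q hq
    have hq := (Finset.mem_filter.1 hq).2
    have h0 : q.1.2 ≠ 0 := by
      have := q.2.1
      rw [Ne, Fin.ext_iff, Fin.val_zero]; omega
    refine ⟨q.1.2.pred h0, Finset.mem_univ _, ?_⟩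
    simp [botIdx, triIdx, Subtype.ext_iff, Prod.ext_iff, hq]

theorem netflow_gr_unused (hG : ∀ e ∈ G, e.1 < e.2) (f : TriIdx n ⊕ ↥(EG0 n G) → ℝ)
    (i j : Fin (n + 1)) (h : ¬ (1 ≤ (j : ℕ) ∧ (j : ℕ) ≤ i)) :
    netflow (srcGr n G) (tgtGr n G) f (some (i, j)) = 0 := by
  have h1 : ∀ q, srcGr n G q ≠ some (i, j) := by
    rintro (q | e) h'
    · have := q.2
      simp only [srcGr, Option.some.injEq] at h'
      rw [h'] at this
      exact h this
    · have := lt_of_mem_EG0 hG e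
      simp [srcGr, Prod.ext_iff, Fin.ext_iff] at h'
      omega
  have h2 : ∀ q, tgtGr n G q ≠ some (i, j) := by
    rintro (q | e) h'
    · have := q.2
      simp only [tgtGr] at h'
      split_ifs at h'
      simp [Prod.ext_iff, Fin.ext_iff] at h'
      omega
    · have := lt_of_mem_EG0 hG e
      simp [tgtGr, Prod.ext_iff, Fin.ext_iff] at h'
      omega
  simp [netflow, h1, h2]

theorem netflow_h_some (g : ↥(EG0 n G) ⊕ Fin n → ℝ) (j : Fin n) :
    netflow (srcH n G) (tgtH n G) g (some j.succ) =
      (∑ e : ↥(EG0 n G), if e.1.1 = j.succ then g (Sum.inl e) else 0) + g (Sum.inr j) -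
        ∑ e : ↥(EG0 n G), if e.1.2 = j.succ then g (Sum.inl e) else 0 := by
  simp [netflow, Fintype.sum_sum_type, srcH, tgtH]

theorem netflow_h_zero (hG : ∀ e ∈ G, e.1 < e.2) (g : ↥(EG0 n G) ⊕ Fin n → ℝ) :
    netflow (srcH n G) (tgtH n G) g (some 0) = 0 := by
  have h1 : ∀ e : ↥(EG0 n G), e.1.1 ≠ 0 := by
    intro e h
    have := lt_of_mem_EG0 hG e
    simp [h] at this
  have h2 : ∀ e : ↥(EG0 n G), e.1.2 ≠ 0 := by
    intro e h
    have := lt_of_mem_EG0 hG e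
    simp [h] at this
  simp [netflow, Fintype.sum_sum_type, srcH, tgtH, h1, h2]

theorem netflow_h_none (g : ↥(EG0 n G) ⊕ Fin n → ℝ) :
    netflow (srcH n G) (tgtH n G) g none = - ∑ j : Fin n, g (Sum.inr j) := by
  simp [netflow, Fintype.sum_sum_type, srcH, tgtH]

theorem fval_succ (i j : ℕ) : fval n F (i + 1) j =
    fval n F i j + (F.filter fun e => (e.1 : ℕ) = j ∧ (e.2 : ℕ) = i + 1).card := by
  rw [fval, fval, ← Finset.card_union_of_disjoint]
  · congr 1
    ext e
    simp only [Finset.mem_union, Finset.mem_filter, ← and_or_left]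
    refine and_congr_right fun _ => ?_
    omega
  · rw [Finset.disjoint_left]
    intro e h1 h2
    simp only [Finset.mem_filter] at h1 h2
    omega

theorem aGrF_next (hF : F ⊆ EG0 n G) (p : TriIdx n) (hp : (p.1.1 : ℕ) < n) :
    aGrF n G F (some (p.next hp).1) =
      - ∑ e : ↥(EG0 n G), if e.1.1 = p.1.2 ∧ (e.1.2 : ℕ) = p.1.1 + 1 then indF F e.1 else 0 := by
  have hp2 := p.2
  rw [sum_indF hF (fun e => e.1 = p.1.2 ∧ (e.2 : ℕ) = p.1.1 + 1)]
  have hne : (⟨(p.1.1 : ℕ) + 1, by omega⟩ : Fin (n + 1)) ≠ p.1.2 := by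
    rw [Ne, Fin.ext_iff]; simp; omega
  have hlt : 1 ≤ (p.1.2 : ℕ) ∧ (p.1.2 : ℕ) < p.1.1 + 1 := by omega
  simp only [aGrF, TriIdx.next, triIdx, hne, if_false, hlt, if_true, and_self,
    Nat.add_sub_cancel, fval_succ, Fin.ext_iff]
  push_cast
  ring

theorem aGrF_none (hG : ∀ e ∈ G, e.1 < e.2) (hF : F ⊆ EG0 n G) :
    aGrF n G F none = -((G.card : ℝ) - F.card) := by
  have h : F.card = ∑ k ∈ Finset.Icc 1 (n - 1), fval n F n k := by
    rw [Finset.card_eq_sum_card_fiberwise (f := fun e => (e.1 : ℕ)) (t := Finset.Icc 1 (n - 1))]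
    · refine Finset.sum_congr rfl fun k _ => ?_
      simp only [fval]
      congr 1
      ext e
      have := e.2.2
      simp only [Finset.mem_filter]
      constructor
      · rintro ⟨h1, h2⟩; exact ⟨h1, h2, by omega⟩
      · rintro ⟨h1, h2, _⟩; exact ⟨h1, h2⟩
    · intro e he
      have h1 := lt_of_mem_EG0 hG ⟨e, hF he⟩
      have h2 := e.2.2
      simp at h1 ⊢
      omega
  simp only [aGrF, h]
  push_cast
  ring

theorem mem_flowPolytope_gr_iff (hG : ∀ e ∈ G, e.1 < e.2) (hF : F ⊆ EG0 n G)
    (f : TriIdx n ⊕ ↥(EG0 n G) → ℝ) :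
    f ∈ flowPolytope (srcGr n G) (tgtGr n G) (aGrF n G F) ↔
      (∀ e, 0 ≤ f e) ∧
      (∀ (j : Fin (n + 1)) (hj : 1 ≤ (j : ℕ)), f (Sum.inl (triIdx j j hj le_rfl)) =
        indeg n G j + ∑ e : ↥(EG0 n G), if e.1.2 = j then f (Sum.inr e) else 0) ∧
      (∀ (p : TriIdx n) (hp : (p.1.1 : ℕ) < n), f (Sum.inl p) = f (Sum.inl (p.next hp)) +
        ∑ e : ↥(EG0 n G), if e.1.1 = p.1.2 ∧ (e.1.2 : ℕ) = p.1.1 + 1 then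
          f (Sum.inr e) + indF F e.1 else 0) ∧
      ∑ j : Fin n, f (Sum.inl (botIdx j)) = G.card - F.card := by
  have split_add (p : TriIdx n) : (∑ e : ↥(EG0 n G),
      if e.1.1 = p.1.2 ∧ (e.1.2 : ℕ) = p.1.1 + 1 then f (Sum.inr e) + indF F e.1 else 0) =
      (∑ e : ↥(EG0 n G),
        if e.1.1 = p.1.2 ∧ (e.1.2 : ℕ) = p.1.1 + 1 then f (Sum.inr e) else 0) +
      ∑ e : ↥(EG0 n G), if e.1.1 = p.1.2 ∧ (e.1.2 : ℕ) = p.1.1 + 1 then indF F e.1 else 0 := by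
    rw [← Finset.sum_add_distrib]
    exact Finset.sum_congr rfl fun e _ => by split_ifs <;> simp
  simp only [split_add]
  change ((∀ e, 0 ≤ f e) ∧ ∀ v, netflow (srcGr n G) (tgtGr n G) f v = aGrF n G F v) ↔ _
  refine and_congr_right fun _ => ⟨fun h => ⟨fun j hj => ?_, fun p hp => ?_, ?_⟩, ?_⟩
  · have h1 := h (some (j, j))
    rw [netflow_gr_diag hG f j hj] at h1
    simp only [aGrF, if_true, hj] at h1
    linarith
  · have h1 := h (some (p.next hp).1)
    rw [netflow_gr_next f p hp, aGrF_next hF] at h1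
    linarith
  · have h1 := h none
    rw [netflow_gr_none, aGrF_none hG hF] at h1
    linarith
  · rintro ⟨hdiag, hnext, hbot⟩ (_ | ⟨i, j⟩)
    · rw [netflow_gr_none, aGrF_none hG hF, hbot]
    · by_cases hij : 1 ≤ (j : ℕ) ∧ (j : ℕ) ≤ i
      · rcases hij.2.eq_or_lt with h | h
        · obtain rfl : j = i := Fin.ext h
          rw [netflow_gr_diag hG f j hij.1, hdiag j hij.1]
          simp [aGrF, hij.1]
        · have hi := i.2
          obtain ⟨p, hp, key⟩ : ∃ (p : TriIdx n) (hp : (p.1.1 : ℕ) < n),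
              (p.next hp).1 = (i, j) := by
            refine ⟨triIdx ⟨(i : ℕ) - 1, by omega⟩ j hij.1 (Nat.le_sub_one_of_lt h),
              show (i : ℕ) - 1 < n by omega, ?_⟩
            simp [TriIdx.next, triIdx, Fin.ext_iff]
            omega
          rw [← key, netflow_gr_next, aGrF_next hF]
          have := hnext p hp
          linarith
      · rw [netflow_gr_unused hG f i j hij]
        have h1 : ¬ (1 ≤ (j : ℕ) ∧ (j : ℕ) < i) := fun h => hij ⟨h.1, h.2.le⟩
        simp only [aGrF, h1, if_false]
        split_ifs with h2 h3
        · subst h2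
          exact absurd ⟨h3, le_rfl⟩ hij
        · rfl
        · rfl

theorem mem_flowPolytope_h_iff (hG : ∀ e ∈ G, e.1 < e.2) (g : ↥(EG0 n G) ⊕ Fin n → ℝ) :
    g ∈ flowPolytope (srcH n G) (tgtH n G) (bGF n G F) ↔
      (∀ e, 0 ≤ g e) ∧
      (∀ j : Fin n,
        (∑ e : ↥(EG0 n G), if e.1.1 = j.succ then g (Sum.inl e) else 0) + g (Sum.inr j) -
          (∑ e : ↥(EG0 n G), if e.1.2 = j.succ then g (Sum.inl e) else 0) =
        indeg n G j.succ - outdeg n F j.succ) ∧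
      ∑ j : Fin n, g (Sum.inr j) = G.card - F.card := by
  change ((∀ e, 0 ≤ g e) ∧ ∀ v, netflow (srcH n G) (tgtH n G) g v = bGF n G F v) ↔ _
  refine and_congr_right fun _ => ⟨fun h => ⟨fun j => ?_, ?_⟩, ?_⟩
  · rw [← netflow_h_some, h]
    simp [bGF]
  · have h1 := h none
    rw [netflow_h_none] at h1
    simp only [bGF] at h1
    linarith
  · rintro ⟨h1, h2⟩ (_ | v)
    · rw [netflow_h_none, h2]
      rfl
    · induction v using Fin.cases with
      | zero => rw [netflow_h_zero hG]; simp [bGF]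
      | succ j => rw [netflow_h_some, h1]; simp [bGF]

/-- The element `j - 1` of `Fin n` attached to the index `(i, j)`. -/
def TriIdx.col (p : TriIdx n) : Fin n := ⟨(p.1.2 : ℕ) - 1, by have := p.2.1; omega⟩

theorem TriIdx.succ_col (p : TriIdx n) : p.col.succ = p.1.2 := by
  have := p.2.1
  simp [TriIdx.col, Fin.ext_iff]
  omega

/-- The sum of `c` over the edges `(j, k)` of `G` with `k > i`, for `p = (i, j)`. -/
def tailSum (p : TriIdx n) (c : ↥(EG0 n G) → ℝ) : ℝ :=
  ∑ e : ↥(EG0 n G), if e.1.1 = p.1.2 ∧ p.1.1 < e.1.2 then c e else 0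

theorem tailSum_next (p : TriIdx n) (hp : (p.1.1 : ℕ) < n) (c : ↥(EG0 n G) → ℝ) :
    tailSum p c = tailSum (p.next hp) c +
      ∑ e : ↥(EG0 n G), if e.1.1 = p.1.2 ∧ (e.1.2 : ℕ) = p.1.1 + 1 then c e else 0 := by
  simp only [tailSum, ← Finset.sum_add_distrib]
  refine Finset.sum_congr rfl fun e _ => ?_
  simp only [TriIdx.next, triIdx, Fin.lt_def]
  by_cases h : e.1.1 = p.1.2
  · simp only [h, true_and]
    split_ifs <;> first | omega | simp
  · simp [h]

theorem tailSum_bot (p : TriIdx n) (hp : p.1.1 = Fin.last n) (c : ↥(EG0 n G) → ℝ) :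
    tailSum p c = 0 := by
  simp [tailSum, hp, (Fin.le_last _).not_gt]

theorem tailSum_add (p : TriIdx n) (c d : ↥(EG0 n G) → ℝ) :
    tailSum p (fun e => c e + d e) = tailSum p c + tailSum p d := by
  simp only [tailSum, ← Finset.sum_add_distrib]
  exact Finset.sum_congr rfl fun e _ => by split_ifs <;> simp

/-- The linear part of the affine map inverting the contraction of `Gr(G)` onto `H_G`. -/
def uncontractLinear (n : ℕ) (G : Finset (Fin (n + 1) × Fin (n + 1))) :
    (↥(EG0 n G) ⊕ Fin n → ℝ) →ₗ[ℝ] (TriIdx n ⊕ ↥(EG0 n G) → ℝ) where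
  toFun g := Sum.elim (fun p => g (Sum.inr p.col) + tailSum p (fun e => g (Sum.inl e)))
    (fun e => g (Sum.inl e))
  map_add' g g' := by
    ext (p | e)
    · simp [tailSum_add]; ring
    · simp
  map_smul' c g := by
    ext (p | e)
    · simp [tailSum, mul_add, Finset.mul_sum]
    · simp

/-- The affine map inverting the contraction of `Gr(G)` onto `H_G`. -/
def uncontract (n : ℕ) (G F : Finset (Fin (n + 1) × Fin (n + 1))) :
    (↥(EG0 n G) ⊕ Fin n → ℝ) →ᵃ[ℝ] (TriIdx n ⊕ ↥(EG0 n G) → ℝ) :=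
  (uncontractLinear n G).toAffineMap + AffineMap.const ℝ _
    (Sum.elim (fun p => tailSum p (fun e : ↥(EG0 n G) => indF F e.1)) (fun _ => 0))

theorem uncontract_inl (g : ↥(EG0 n G) ⊕ Fin n → ℝ) (p : TriIdx n) :
    uncontract n G F g (Sum.inl p) =
      g (Sum.inr p.col) + tailSum p (fun e => g (Sum.inl e) + indF F e.1) := by
  simp [uncontract, uncontractLinear, tailSum_add, add_assoc]

theorem uncontract_inr (g : ↥(EG0 n G) ⊕ Fin n → ℝ) (e : ↥(EG0 n G)) :
    uncontract n G F g (Sum.inr e) = g (Sum.inl e) := by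
  simp [uncontract, uncontractLinear]

theorem tailSum_diag (hG : ∀ e ∈ G, e.1 < e.2) (hF : F ⊆ EG0 n G)
    (j : Fin (n + 1)) (hj : 1 ≤ (j : ℕ)) (c : ↥(EG0 n G) → ℝ) :
    tailSum (triIdx j j hj le_rfl) (fun e => c e + indF F e.1) =
      (∑ e : ↥(EG0 n G), if e.1.1 = j then c e else 0) + outdeg n F j := by
  rw [outdeg, ← sum_indF hF, ← Finset.sum_add_distrib]
  refine Finset.sum_congr rfl fun e _ => ?_
  have := lt_of_mem_EG0 hG e
  by_cases h : e.1.1 = j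
  · have h' : j < e.1.2 := by rw [← h]; exact this.2
    simp [triIdx, h, h']
  · simp [triIdx, h]

theorem botIdx_col (p : TriIdx n) (hp : p.1.1 = Fin.last n) : botIdx p.col = p := by
  simp [botIdx, triIdx, TriIdx.succ_col, Subtype.ext_iff, Prod.ext_iff, hp]

theorem col_botIdx (j : Fin n) : (botIdx j).col = j := by
  simp [botIdx, triIdx, TriIdx.col]

theorem col_diag (j : Fin n) (h : 1 ≤ (j.succ : ℕ)) :
    (triIdx j.succ j.succ h le_rfl : TriIdx n).col = j := by
  simp [triIdx, TriIdx.col]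

theorem eq_bot_add_tailSum {f : TriIdx n ⊕ ↥(EG0 n G) → ℝ}
    (hnext : ∀ (p : TriIdx n) (hp : (p.1.1 : ℕ) < n), f (Sum.inl p) = f (Sum.inl (p.next hp)) +
      ∑ e : ↥(EG0 n G), if e.1.1 = p.1.2 ∧ (e.1.2 : ℕ) = p.1.1 + 1 then
        f (Sum.inr e) + indF F e.1 else 0) (p : TriIdx n) :
    f (Sum.inl p) =
      f (Sum.inl (botIdx p.col)) + tailSum p (fun e => f (Sum.inr e) + indF F e.1) := by
  induction hk : n - (p.1.1 : ℕ) generalizing p with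
  | zero =>
    have hp : p.1.1 = Fin.last n := by
      have := p.1.1.2
      rw [Fin.ext_iff]; simp; omega
    rw [tailSum_bot p hp, botIdx_col p hp, add_zero]
  | succ k ih =>
    have hp : (p.1.1 : ℕ) < n := by omega
    rw [hnext p hp, tailSum_next p hp, ih (p.next hp) (by simp [TriIdx.next, triIdx]; omega)]
    simp only [TriIdx.next, triIdx, TriIdx.col, add_assoc]

end GrContraction

/-- Theorem: contracting `Gr(G)`.  For a simple graph `G` on `[0,n]`
and `F ⊆ E(G\0)`, the flow polytopes `F_{Gr(G)}(a_G^F)` and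
`F_{H_G}(d_1^F, …, d_n^F, −#E(G\F))` are integrally equivalent, where
`d_j^F = indeg_G(j) − outdeg_F(j)`. -/
theorem gr_flow_polytope_equiv (n : ℕ) (G : Finset (Fin (n + 1) × Fin (n + 1)))
    (hG : ∀ e ∈ G, e.1 < e.2) (F : Finset (Fin (n + 1) × Fin (n + 1)))
    (hF : F ⊆ EG0 n G) :
    IntegrallyEquivalent (flowPolytope (srcGr n G) (tgtGr n G) (aGrF n G F))
      (flowPolytope (srcH n G) (tgtH n G) (bGF n G F)) := by
  refine IntegrallyEquivalent.of_inverse (LinearMap.funLeft ℝ ℝ (grEdge n G)).toAffineMap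
    (uncontract n G F) ?_ ?_ ?_ ?_ ?_ ?_
  · intro f hf
    obtain ⟨hnonneg, hdiag, hnext, hbot⟩ := (mem_flowPolytope_gr_iff hG hF f).1 hf
    refine (mem_flowPolytope_h_iff hG _).2 ⟨fun e => hnonneg _, fun j => ?_, hbot⟩
    have h1 := eq_bot_add_tailSum hnext (triIdx j.succ j.succ (by simp) le_rfl)
    rw [hdiag, tailSum_diag hG hF, col_diag] at h1
    simp only [LinearMap.coe_toAffineMap, LinearMap.funLeft_apply, grEdge]
    linarith
  · intro g hg
    obtain ⟨hnonneg, hvert, hbot⟩ := (mem_flowPolytope_h_iff hG g).1 hg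
    refine (mem_flowPolytope_gr_iff hG hF _).2 ⟨?_, fun j hj => ?_, fun p hp => ?_, ?_⟩
    · rintro (p | e)
      · rw [uncontract_inl]
        refine add_nonneg (hnonneg _) (Finset.sum_nonneg fun e _ => ?_)
        have h1 := hnonneg (Sum.inl e)
        have h2 : 0 ≤ indF F e.1 := by unfold indF; split_ifs <;> simp
        split_ifs <;> positivity
      · rw [uncontract_inr]
        exact hnonneg _
    · obtain ⟨j, rfl⟩ := Fin.exists_succ_eq.2 (show j ≠ 0 by rintro rfl; simp at hj)
      simp only [uncontract_inr]
      have h1 := hvert j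
      rw [uncontract_inl, tailSum_diag hG hF, col_diag]
      linarith
    · simp only [uncontract_inr, uncontract_inl]
      rw [tailSum_next p hp, add_assoc]
      rfl
    · rw [← hbot]
      refine Finset.sum_congr rfl fun j _ => ?_
      rw [uncontract_inl, tailSum_bot _ rfl, col_botIdx, add_zero]
  · intro f hf
    obtain ⟨-, -, hnext, -⟩ := (mem_flowPolytope_gr_iff hG hF f).1 hf
    ext (p | e)
    · rw [uncontract_inl, eq_bot_add_tailSum hnext p]
      rfl
    · rw [uncontract_inr]
      rfl
  · intro g _
    ext (e | j)
    · exact uncontract_inr g e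
    · change uncontract n G F g (Sum.inl (botIdx j)) = _
      rw [uncontract_inl, tailSum_bot _ rfl, col_botIdx, add_zero]
  · exact fun x hx k => hx _
  · rintro y hy (p | e)
    · choose z hz using hy
      refine ⟨z (Sum.inr p.col) + ∑ e : ↥(EG0 n G), if e.1.1 = p.1.2 ∧ p.1.1 < e.1.2 then
        z (Sum.inl e) + (if e.1 ∈ F then 1 else 0) else 0, ?_⟩
      rw [uncontract_inl]
      push_cast
      simp only [tailSum, hz, indF]
    · rw [uncontract_inr]
      exact hy _
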